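/- Let X be a compact metric space equipped with a Borel probability measure dx, and assume there exists a sequence (g_k)_{k≥1} in X such that W₁((1/n) ∑_{k=1}^n δ_{g_k}, dx) → 0 as n → ∞. Then for every N₀ ≥ 1 there exists K₀ ≥ 1 such that for every integer K ≥ K₀ and every sequence (x_i)_{i≥1} in X there exists a sequence (y_j)_{j≥1} in X with the following property: for every N with 1 ≤ N ≤ N₀, writing μ_N = ∑_{i=1}^N δ_{x_i} − ∑_{j=1}^{N+K} δ_{y_j}, one has 𝐖₁^{1,1}((1/(2N+K)) μ_N, dx) > 𝐖₁^{1,1}((1/(2N+K)) (−μ_N), dx). In other words, if the rival opens one shop each time we do but starts with a head start of K shops, then for K large enough the rival has a winning strategy for all N ≤ N₀. -/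

import Mathlib

open MeasureTheory Filter Metric
open scoped ENNReal

section Defs

variable {X : Type*} [MeasurableSpace X] [MetricSpace X]

/-- A transference plan (coupling) between `μ` and `ν`: a measure on `X × X`
whose marginals are `μ` and `ν`. -/
def IsCoupling (μ ν : Measure X) (π : Measure (X × X)) : Prop :=
  π.map Prod.fst = μ ∧ π.map Prod.snd = ν

/-- The 1-Wasserstein distance between two (nonnegative) measures of equal mass:
the infimum over couplings of the transport cost. -/
noncomputable def W1 (μ ν : Measure X) : ℝ :=
  sInf { r : ℝ | ∃ π : Measure (X × X), IsCoupling μ ν π ∧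
    r = ∫ p : X × X, dist p.1 p.2 ∂π }

/-- The total variation norm `‖μ - ν‖` of the difference of two finite measures. -/
noncomputable def tvNorm (μ ν : Measure X) : ℝ :=
  ((μ - ν) Set.univ + (ν - μ) Set.univ).toReal

/-- The generalized Wasserstein distance `W₁^{a,b}` between two finite nonnegative
measures, possibly of different total mass (Piccoli–Rossi). -/
noncomputable def genW (a b : ℝ) (μ ν : Measure X) : ℝ :=
  sInf { r : ℝ | ∃ μ' ν' : Measure X, IsFiniteMeasure μ' ∧ IsFiniteMeasure ν' ∧
    μ' Set.univ = ν' Set.univ ∧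
    r = a * (tvNorm μ μ' + tvNorm ν ν') + b * W1 μ' ν' }

/-- The signed generalized Wasserstein distance `𝐖₁^{a,b}` between finite signed
measures, defined via the Jordan decompositions. -/
noncomputable def signedW (a b : ℝ) (μ ν : SignedMeasure X) : ℝ :=
  genW a b (μ.toJordanDecomposition.posPart + ν.toJordanDecomposition.negPart)
    (μ.toJordanDecomposition.negPart + ν.toJordanDecomposition.posPart)

/-- The empirical (probability) measure of the first `n` points of a sequence. -/
noncomputable def emp (x : ℕ → X) (n : ℕ) : Measure X :=
  (n : ℝ≥0∞)⁻¹ • ∑ k ∈ Finset.range n, Measure.dirac (x k)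

/-- The (unnormalized) empirical signed measure of the first `n` points of a sequence. -/
noncomputable def sEmp (x : ℕ → X) (n : ℕ) : SignedMeasure X :=
  ∑ k ∈ Finset.range n, (Measure.dirac (x k)).toSignedMeasure

end Defs

open scoped NNReal

section GeneralizedWasserstein

variable {X : Type*} [MeasurableSpace X]

section TotalVariation

variable (μ ν : Measure X)

theorem tvNorm_comm : tvNorm μ ν = tvNorm ν μ := by
  rw [tvNorm, tvNorm, add_comm]

variable [IsFiniteMeasure μ] [IsFiniteMeasure ν]

theorem real_univ_sub_real_univ :
    μ.real Set.univ - ν.real Set.univ =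
      (μ - ν).real Set.univ - (ν - μ).real Set.univ := by
  have h := congrArg (fun s : SignedMeasure X => s Set.univ)
    (Measure.sub_toSignedMeasure_eq_toSignedMeasure_sub (μ := μ) (ν := ν))
  simpa [Measure.toSignedMeasure_sub_apply MeasurableSet.univ] using h

theorem tvNorm_eq_real_add_real :
    tvNorm μ ν = (μ - ν).real Set.univ + (ν - μ).real Set.univ :=
  ENNReal.toReal_add (measure_ne_top _ _) (measure_ne_top _ _)

theorem abs_real_univ_sub_le_tvNorm :
    |μ.real Set.univ - ν.real Set.univ| ≤ tvNorm μ ν := by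
  rw [real_univ_sub_real_univ, tvNorm_eq_real_add_real, abs_le]
  have h₁ : 0 ≤ (μ - ν).real Set.univ := measureReal_nonneg
  have h₂ : 0 ≤ (ν - μ).real Set.univ := measureReal_nonneg
  constructor <;> linarith

variable {μ ν}

theorem tvNorm_of_le (h : μ ≤ ν) : tvNorm μ ν = ν.real Set.univ - μ.real Set.univ := by
  rw [tvNorm_eq_real_add_real, real_univ_sub_real_univ, Measure.sub_eq_zero_of_le h]
  simp

end TotalVariation

variable [MetricSpace X]

theorem W1_nonneg (μ ν : Measure X) : 0 ≤ W1 μ ν := by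
  apply Real.sInf_nonneg
  rintro _ ⟨π, -, rfl⟩
  exact integral_nonneg fun _ => dist_nonneg

theorem genW_one_one_le (μ ν μ' ν' : Measure X) [IsFiniteMeasure μ'] [IsFiniteMeasure ν']
    (h : μ' Set.univ = ν' Set.univ) :
    genW 1 1 μ ν ≤ tvNorm μ μ' + tvNorm ν ν' + W1 μ' ν' := by
  refine csInf_le ⟨0, ?_⟩ ⟨μ', ν', inferInstance, inferInstance, h, by ring⟩
  rintro _ ⟨ρ, σ, -, -, -, rfl⟩
  have h₁ : 0 ≤ tvNorm μ ρ := ENNReal.toReal_nonneg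
  have h₂ : 0 ≤ tvNorm ν σ := ENNReal.toReal_nonneg
  have h₃ := W1_nonneg ρ σ
  linarith

theorem abs_real_univ_sub_le_genW (μ ν : Measure X) [IsFiniteMeasure μ] [IsFiniteMeasure ν] :
    |μ.real Set.univ - ν.real Set.univ| ≤ genW 1 1 μ ν := by
  refine le_csInf ⟨_, 0, 0, inferInstance, inferInstance, rfl, rfl⟩ ?_
  rintro _ ⟨ρ, σ, _, _, h, rfl⟩
  have h₁ := abs_le.1 (abs_real_univ_sub_le_tvNorm μ ρ)
  have h₂ := abs_le.1 (abs_real_univ_sub_le_tvNorm ν σ)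
  have h₃ := W1_nonneg ρ σ
  have h₄ : ρ.real Set.univ = σ.real Set.univ := congrArg ENNReal.toReal h
  rw [abs_le]
  constructor <;> linarith

theorem abs_apply_univ_sub_le_signedW (s t : SignedMeasure X) :
    |s Set.univ - t Set.univ| ≤ signedW 1 1 s t := by
  refine le_trans (le_of_eq ?_) (abs_real_univ_sub_le_genW _ _)
  rw [s.apply_eq_posPart_real_sub_negPart_real MeasurableSet.univ,
    t.apply_eq_posPart_real_sub_negPart_real MeasurableSet.univ,
    measureReal_add_apply, measureReal_add_apply]
  congr 1
  ring

theorem signedW_sub_le (a b d p : Measure X) [IsFiniteMeasure a] [IsFiniteMeasure b]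
    [IsFiniteMeasure d] [IsFiniteMeasure p] (hap : a ≤ p) (hpd : p Set.univ = d Set.univ) :
    signedW 1 1 (a.toSignedMeasure - b.toSignedMeasure) d.toSignedMeasure ≤
      p.real Set.univ - a.real Set.univ + 2 * b.real Set.univ + W1 p d := by
  have hd : d.toSignedMeasure.toJordanDecomposition =
      Measure.jordanDecompositionOfToSignedMeasureSub d 0 := by
    rw [← Measure.toJordanDecomposition_toSignedMeasure_sub, Measure.toSignedMeasure_zero,
      sub_zero]
  rw [signedW, hd, Measure.toJordanDecomposition_toSignedMeasure_sub]
  simp only [Measure.jordanDecompositionOfToSignedMeasureSub_posPart,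
    Measure.jordanDecompositionOfToSignedMeasureSub_negPart, Measure.zero_sub,
    Measure.sub_zero, add_zero]
  refine (genW_one_one_le _ _ p d hpd).trans ?_
  rw [tvNorm_of_le (Measure.sub_le.trans hap), tvNorm_comm,
    tvNorm_of_le (Measure.le_add_left le_rfl), measureReal_add_apply]
  have h₁ := real_univ_sub_real_univ a b
  have h₂ : (b - a).real Set.univ ≤ b.real Set.univ :=
    ENNReal.toReal_mono (measure_ne_top _ _) (Measure.sub_le Set.univ)
  have h₃ : 0 ≤ (b - a).real Set.univ := measureReal_nonneg
  linarith

end GeneralizedWasserstein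

section Empirical

variable {X : Type*} [MeasurableSpace X] (x : ℕ → X) (n : ℕ)

instance isFiniteMeasure_sum_dirac :
    IsFiniteMeasure (∑ k ∈ Finset.range n, Measure.dirac (x k)) :=
  ⟨by simp⟩

theorem real_sum_dirac_univ :
    (∑ k ∈ Finset.range n, Measure.dirac (x k)).real Set.univ = n := by
  simp [measureReal_def]

theorem sEmp_eq_toSignedMeasure :
    sEmp x n = (∑ k ∈ Finset.range n, Measure.dirac (x k)).toSignedMeasure := by
  induction n with
  | zero => simp [sEmp]
  | succ n ih =>
    rw [sEmp, Finset.sum_range_succ, ← sEmp, ih, ← Measure.toSignedMeasure_add]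
    exact Measure.toSignedMeasure_congr (Finset.sum_range_succ _ _).symm

theorem sEmp_univ : sEmp x n Set.univ = n := by
  rw [sEmp_eq_toSignedMeasure, Measure.toSignedMeasure_apply_measurable MeasurableSet.univ,
    real_sum_dirac_univ]

variable {n}

theorem emp_univ (hn : n ≠ 0) : emp x n Set.univ = 1 := by
  simp [emp, ENNReal.inv_mul_cancel (Nat.cast_ne_zero.2 hn) (ENNReal.natCast_ne_top n)]

theorem smul_sum_dirac_le_emp (hn : n ≠ 0) {m : ℕ} (hnm : n ≤ m) :
    ((m : ℝ≥0)⁻¹ • ∑ k ∈ Finset.range n, Measure.dirac (x k)) ≤ emp x n := by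
  have h : ((m : ℝ≥0)⁻¹ : ℝ≥0) = ((m : ℝ≥0∞)⁻¹ : ℝ≥0∞) := by
    rw [ENNReal.coe_inv (by simp; omega), ENNReal.coe_natCast]
  refine Measure.le_iff'.2 fun s => ?_
  rw [emp, Measure.smul_apply, Measure.smul_apply, ENNReal.smul_def, h, smul_eq_mul, smul_eq_mul]
  gcongr

end Empirical

/-- If there exists a sequence whose empirical measures converge to `dx`
in `W₁`, then for every `N₀` there is `K₀` such that for every head start `K ≥ K₀` the
rival has a winning strategy for all `1 ≤ N ≤ N₀`:
`𝐖₁^{1,1}(μ_N/(2N+K), dx) > 𝐖₁^{1,1}(−μ_N/(2N+K), dx)`, where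
`μ_N = ∑_{i=1}^N δ_{x_i} − ∑_{j=1}^{N+K} δ_{y_j}`. -/
theorem rival_wins_of_head_start {X : Type*} [MeasurableSpace X] [MetricSpace X]
    [BorelSpace X] [CompactSpace X] (dx : Measure X) [IsProbabilityMeasure dx]
    (hg : ∃ g : ℕ → X, Tendsto (fun n : ℕ => W1 (emp g n) dx) atTop (nhds 0)) :
    ∀ N₀ : ℕ, 1 ≤ N₀ → ∃ K₀ : ℕ, 1 ≤ K₀ ∧ ∀ K : ℕ, K₀ ≤ K →
      ∀ x : ℕ → X, ∃ y : ℕ → X, ∀ N : ℕ, 1 ≤ N → N ≤ N₀ →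
        signedW 1 1
            (((2 * N + K : ℕ) : ℝ)⁻¹ • (-(sEmp x N - sEmp y (N + K))))
            dx.toSignedMeasure <
          signedW 1 1
            (((2 * N + K : ℕ) : ℝ)⁻¹ • (sEmp x N - sEmp y (N + K)))
            dx.toSignedMeasure := by
  obtain ⟨g, hg⟩ := hg
  intro N₀ _
  obtain ⟨n₁, hn₁⟩ := eventually_atTop.1 (hg.eventually (gt_mem_nhds one_half_pos))
  refine ⟨n₁ + 6 * N₀ + 1, by omega, fun K hK x => ⟨g, fun N hN hNN₀ => ?_⟩⟩
  have hW : W1 (emp g (N + K)) dx < 1 / 2 := hn₁ _ (by omega)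
  have hemp := emp_univ g (n := N + K) (by omega)
  have : IsFiniteMeasure (emp g (N + K)) := ⟨by rw [hemp]; exact ENNReal.one_lt_top⟩
  have hM : (0 : ℝ) < 2 * N + K := by positivity
  have hNM : 6 * (N : ℝ) < 2 * N + K := by exact_mod_cast (by omega : 6 * N < 2 * N + K)
  have hupper := signedW_sub_le
    (((2 * N + K : ℕ) : ℝ≥0)⁻¹ • ∑ k ∈ Finset.range (N + K), Measure.dirac (g k))
    (((2 * N + K : ℕ) : ℝ≥0)⁻¹ • ∑ k ∈ Finset.range N, Measure.dirac (x k))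
    dx (emp g (N + K)) (smul_sum_dirac_le_emp g (by omega) (by omega)) (by rw [hemp, measure_univ])
  have hlower := abs_apply_univ_sub_le_signedW
    (((2 * N + K : ℕ) : ℝ)⁻¹ • (sEmp x N - sEmp g (N + K))) dx.toSignedMeasure
  have hs : ((2 * N + K : ℕ) : ℝ)⁻¹ • (-(sEmp x N - sEmp g (N + K))) =
      (((2 * N + K : ℕ) : ℝ≥0)⁻¹ • ∑ k ∈ Finset.range (N + K),
        Measure.dirac (g k)).toSignedMeasure -
      (((2 * N + K : ℕ) : ℝ≥0)⁻¹ • ∑ k ∈ Finset.range N,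
        Measure.dirac (x k)).toSignedMeasure := by
    rw [Measure.toSignedMeasure_smul, Measure.toSignedMeasure_smul, ← sEmp_eq_toSignedMeasure,
      ← sEmp_eq_toSignedMeasure, NNReal.smul_def, NNReal.smul_def, neg_sub, smul_sub]
    simp
  rw [hs]
  refine hupper.trans_lt (lt_of_lt_of_le ?_ ((neg_le_abs _).trans hlower))
  rw [measureReal_nnreal_smul_apply, measureReal_nnreal_smul_apply, real_sum_dirac_univ,
    real_sum_dirac_univ, measureReal_def, hemp, _root_.smul_apply,
    _root_.sub_apply, sEmp_univ, sEmp_univ,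
    Measure.toSignedMeasure_apply_measurable MeasurableSet.univ, probReal_univ]
  push_cast
  have hsplit : ((2 : ℝ) * N + K)⁻¹ * (N + K) = 1 - (2 * N + K : ℝ)⁻¹ * N := by
    field_simp
    ring
  have hsmall : (2 * N + K : ℝ)⁻¹ * N < 1 / 6 := by
    rw [inv_mul_lt_iff₀ hM]
    linarith
  simp only [ENNReal.toReal_one, smul_eq_mul, mul_sub]
  rw [hsplit]
  linarith
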